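/- Let 0 < a < 1, set a⋆ := min(a, 1−a), and let a_* be either a or 1−a. There exists a positive constant C₄(a_*) such that for every real k and all real A, B with B ≥ A ≥ 2/a⋆, ∫_A^B | Σ_{2 ≤ n < t/a⋆} e^{2πi n a_*} · sin(k·log n) / (n^{1/2+it} · log n) | dt ≤ C₄(a_*)·B, where the constant is independent of k, A, and B. -/

import Mathlib

open Complex MeasureTheory

/-- The Hurwitz zeta function `ζ(s, a)`. -/
noncomputable def hzeta (a : ℝ) (s : ℂ) : ℂ := HurwitzZeta.hurwitzZeta (a : UnitAddCircle) s

/-- The periodic (exponential) zeta function `Li(s, a)`. -/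
noncomputable def pzeta (a : ℝ) (s : ℂ) : ℂ := HurwitzZeta.expZeta (a : UnitAddCircle) s

/-- The quadrilateral zeta function `Q(s, a)`, defined by
`2Q(s,a) = ζ(s,a) + ζ(s,1−a) + Li(s,a) + Li(s,1−a)`. -/
noncomputable def Qzeta (s : ℂ) (a : ℝ) : ℂ :=
  (hzeta a s + hzeta (1 - a) s + pzeta a s + pzeta (1 - a) s) / 2

/-- The sum `Σ_{2 ≤ n < t/amin} e^{2πi n astar} sin(k log n) / (n^{1/2+it} log n)`. -/
noncomputable def Ssum2 (astar amin k t : ℝ) : ℂ :=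
  ∑ n ∈ Finset.Ico 2 ⌈t / amin⌉₊,
    Complex.exp (2 * Real.pi * Complex.I * n * astar) * (Real.sin (k * Real.log n) : ℂ) /
      ((n : ℂ) ^ ((1 : ℂ) / 2 + Complex.I * t) * (Real.log n : ℂ))

lemma aux_log2 {n : ℕ} (hn : 2 ≤ n) : Real.log 2 ≤ Real.log n :=
  Real.log_le_log (by norm_num) (by exact_mod_cast hn)

lemma aux_l2pos : 0 < Real.log 2 := Real.log_pos (by norm_num)

/-- the diagonal sum -/
lemma aux_diag (N : ℕ) :
    ∑ n ∈ Finset.Ico 2 (N + 3), 1 / ((n : ℝ) * Real.log n ^ 2) ≤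
      (1 / (2 * Real.log 2 ^ 2) + 1 / Real.log 2) - 1 / Real.log (N + 2 : ℕ) := by
  induction N with
  | zero => simp
  | succ N ih =>
    rw [Finset.sum_Ico_succ_top (by omega)]
    have h1 : 0 < Real.log (N + 2 : ℕ) := lt_of_lt_of_le aux_l2pos (aux_log2 (by omega))
    have h2 : 0 < Real.log (N + 3 : ℕ) := lt_of_lt_of_le aux_l2pos (aux_log2 (by omega))
    have h12 : Real.log (N + 2 : ℕ) ≤ Real.log (N + 3 : ℕ) :=
      Real.log_le_log (by positivity) (by push_cast; linarith)
    have hd : 1 / ((N + 3 : ℕ) : ℝ) ≤ Real.log (N + 3 : ℕ) - Real.log (N + 2 : ℕ) := by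
      rw [← Real.log_div (by positivity) (by positivity)]
      have := Real.one_sub_inv_le_log_of_pos
        (show (0 : ℝ) < ((N + 3 : ℕ) : ℝ) / ((N + 2 : ℕ) : ℝ) by positivity)
      refine le_trans (le_of_eq ?_) this
      push_cast
      field_simp
      ring
    have key : 1 / (((N + 3 : ℕ) : ℝ) * Real.log (N + 3 : ℕ) ^ 2) ≤
        1 / Real.log (N + 2 : ℕ) - 1 / Real.log (N + 3 : ℕ) := by
      have e : 1 / Real.log (N + 2 : ℕ) - 1 / Real.log (N + 3 : ℕ) =
        (Real.log (N + 3 : ℕ) - Real.log (N + 2 : ℕ)) /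
          (Real.log (N + 2 : ℕ) * Real.log (N + 3 : ℕ)) := by
        field_simp
      rw [e, ← div_div]
      apply div_le_div₀ (by linarith) hd (by positivity)
      rw [sq]
      gcongr
    have e2 : N + 1 + 2 = N + 3 := by omega
    rw [e2]
    linarith

lemma aux_diag' (N : ℕ) :
    ∑ n ∈ Finset.Ico 2 N, 1 / ((n : ℝ) * Real.log n ^ 2) ≤
      1 / (2 * Real.log 2 ^ 2) + 1 / Real.log 2 := by
  have h := aux_diag N
  have h1 : 0 < Real.log (N + 2 : ℕ) := lt_of_lt_of_le aux_l2pos (aux_log2 (by omega))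
  have h2 : 0 < 1 / Real.log (N + 2 : ℕ) := by positivity
  refine le_trans (Finset.sum_le_sum_of_subset_of_nonneg
    (Finset.Ico_subset_Ico_right (show N ≤ N + 3 by omega)) ?_) (by linarith)
  intro i _ _
  positivity

lemma aux_harm (n : ℕ) :
    ∑ m ∈ Finset.Ico 1 n, (1 / (m : ℝ) + 1 / ((n : ℝ) - m)) ≤ 2 * (1 + Real.log n) := by
  rcases Nat.eq_zero_or_pos n with rfl | hn
  · simp
  have h1 : ∑ m ∈ Finset.Ico 1 n, 1 / (m : ℝ) ≤ 1 + Real.log n := by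
    refine le_trans ?_ (harmonic_le_one_add_log n)
    rw [harmonic_eq_sum_Icc]
    push_cast
    simp only [one_div]
    apply Finset.sum_le_sum_of_subset_of_nonneg
    · intro x hx
      simp at hx ⊢
      omega
    · intro i _ _
      positivity
  have h2 : ∑ m ∈ Finset.Ico 1 n, 1 / ((n : ℝ) - m) = ∑ m ∈ Finset.Ico 1 n, 1 / (m : ℝ) := by
    apply Finset.sum_bij' (fun m _ => n - m) (fun m _ => n - m)
    · intro x hx; simp at hx ⊢; omega
    · intro x hx; simp at hx ⊢; omega
    · intro x hx; simp at hx ⊢; omega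
    · intro x hx; simp at hx ⊢; omega
    · intro x hx
      simp at hx
      rw [Nat.cast_sub (by omega)]
  rw [Finset.sum_add_distrib, h2]
  linarith

noncomputable def auxH (m n : ℕ) : ℝ :=
  2 / Real.log 2 * (1 / Real.log n) * (1 / (m : ℝ) + 1 / ((n : ℝ) - m))

noncomputable def auxb (n : ℕ) : ℝ := 1 / (Real.sqrt n * Real.log n)

lemma aux_off {m n : ℕ} (hm : 2 ≤ m) (hmn : m < n) :
    auxb m * auxb n * (2 / |Real.log n - Real.log m|) ≤ auxH m n := by
  have hm0 : (0 : ℝ) < m := by exact_mod_cast (by omega : 0 < m)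
  have hn0 : (0 : ℝ) < n := by exact_mod_cast (by omega : 0 < n)
  have hlt : (m : ℝ) < n := by exact_mod_cast hmn
  have hl2 := aux_l2pos
  have hlm := aux_log2 hm
  have hln := aux_log2 (show 2 ≤ n by omega)
  have hd : ((n : ℝ) - m) / n ≤ Real.log n - Real.log m := by
    rw [← Real.log_div (by positivity) (by positivity)]
    refine le_trans (le_of_eq ?_) (Real.one_sub_inv_le_log_of_pos (by positivity))
    field_simp
  have hpos : 0 < ((n : ℝ) - m) / n := div_pos (by linarith) hn0
  rw [abs_of_pos (by linarith)]
  have hpos2 : 0 < Real.log n - Real.log m := by linarith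
  have hs : (m : ℝ) ≤ Real.sqrt m * Real.sqrt n := by
    calc (m : ℝ) = Real.sqrt m * Real.sqrt m := (Real.mul_self_sqrt hm0.le).symm
      _ ≤ _ := by gcongr
  have hsub : 0 < (n : ℝ) - m := by linarith
  have hlm0 : 0 < Real.log m := by linarith
  have hln0 : 0 < Real.log n := by linarith
  calc auxb m * auxb n * (2 / (Real.log n - Real.log m))
      = 2 / (Real.log m) * (1 / Real.log n) * (1 / (Real.sqrt m * Real.sqrt n)) *
        (1 / (Real.log n - Real.log m)) := by
        unfold auxb
        field_simp
    _ ≤ 2 / (Real.log 2) * (1 / Real.log n) * (1 / (m : ℝ)) *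
        (1 / (((n : ℝ) - m) / n)) := by gcongr
    _ = auxH m n := by
        unfold auxH
        field_simp
        ring

lemma aux_inner {n : ℕ} (hn : 2 ≤ n) :
    ∑ m ∈ Finset.Ico 1 n, auxH m n ≤ 4 / Real.log 2 * (1 / Real.log 2 + 1) := by
  unfold auxH
  rw [← Finset.mul_sum]
  have hl2 := aux_l2pos
  have hln := aux_log2 hn
  have hln0 : 0 < Real.log n := by linarith
  calc _ ≤ 2 / Real.log 2 * (1 / Real.log n) * (2 * (1 + Real.log n)) := by
        gcongr
        exact aux_harm n
    _ = 4 / Real.log 2 * (1 / Real.log n + 1) := by field_simp; ring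
    _ ≤ _ := by gcongr

lemma auxH_nonneg {m n : ℕ} (h : m < n) : 0 ≤ auxH m n := by
  unfold auxH
  have hl2 := aux_l2pos
  have : (0 : ℝ) < n - m := by
    have : (m : ℝ) < n := by exact_mod_cast h
    linarith
  have : 0 ≤ Real.log n := Real.log_natCast_nonneg n
  positivity

/-- The double sum. -/
lemma aux_double (N : ℕ) (B : ℝ) (hB : 0 ≤ B) (J : ℕ → ℕ → ℝ)
    (hd : ∀ n, J n n ≤ B) (ho : ∀ m n, 1 ≤ m → 1 ≤ n → m ≠ n → J m n ≤ 2 / |Real.log n - Real.log m|) :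
    ∑ m ∈ Finset.Ico 2 N, ∑ n ∈ Finset.Ico 2 N, auxb m * auxb n * J m n ≤
      B * (1 / (2 * Real.log 2 ^ 2) + 1 / Real.log 2) +
        2 * (4 / Real.log 2 * (1 / Real.log 2 + 1)) * N := by
  have hb : ∀ n, 0 ≤ auxb n := fun n => by
    unfold auxb
    have : 0 ≤ Real.log n := Real.log_natCast_nonneg n
    positivity
  have h1 : ∑ m ∈ Finset.Ico 2 N, ∑ n ∈ Finset.Ico 2 N, auxb m * auxb n * J m n ≤
      ∑ m ∈ Finset.Ico 2 N, ∑ n ∈ Finset.Ico 2 N,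
        ((if m = n then B * (1 / ((n : ℝ) * Real.log n ^ 2)) else 0) +
          (if m < n then auxH m n else 0) + (if n < m then auxH n m else 0)) := by
    apply Finset.sum_le_sum
    intro m hm
    apply Finset.sum_le_sum
    intro n hn
    rw [Finset.mem_Ico] at hm hn
    rcases lt_trichotomy m n with h | h | h
    · rw [if_neg h.ne, if_pos h, if_neg h.not_gt, zero_add, add_zero]
      refine le_trans ?_ (aux_off hm.1 h)
      exact mul_le_mul_of_nonneg_left (ho m n (by omega) (by omega) h.ne)
        (mul_nonneg (hb _) (hb _))
    · subst h
      simp only [lt_irrefl, if_true, if_false, add_zero]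
      refine le_trans (mul_le_mul_of_nonneg_left (hd m) (mul_nonneg (hb _) (hb _))) (le_of_eq ?_)
      unfold auxb
      have hm0 : (0 : ℝ) < m := by exact_mod_cast (by omega : 0 < m)
      have e : (m : ℝ) = Real.sqrt m * Real.sqrt m := (Real.mul_self_sqrt hm0.le).symm
      rw [div_mul_div_comm, mul_comm B]
      congr 2
      · ring
      · nth_rewrite 5 [e]
        ring
    · rw [if_neg h.ne', if_neg h.not_gt, if_pos h, zero_add, zero_add]
      refine le_trans ?_ (aux_off hn.1 h)
      rw [abs_sub_comm, mul_comm (auxb n)]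
      exact mul_le_mul_of_nonneg_left (ho m n (by omega) (by omega) h.ne')
        (mul_nonneg (hb _) (hb _))
  refine le_trans h1 ?_
  have h2 : ∑ n ∈ Finset.Ico 2 N, ∑ m ∈ Finset.Ico 2 N, (if m < n then auxH m n else 0) ≤
      (4 / Real.log 2 * (1 / Real.log 2 + 1)) * N := by
    have hl2 := aux_l2pos
    calc _ ≤ ∑ n ∈ Finset.Ico 2 N, (4 / Real.log 2 * (1 / Real.log 2 + 1)) := by
          apply Finset.sum_le_sum
          intro n hn
          rw [Finset.mem_Ico] at hn
          refine le_trans ?_ (aux_inner hn.1)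
          rw [← Finset.sum_filter]
          apply Finset.sum_le_sum_of_subset_of_nonneg
          · intro x hx
            simp at hx ⊢
            omega
          · intro i hi _
            simp at hi
            exact auxH_nonneg hi.2
      _ = (4 / Real.log 2 * (1 / Real.log 2 + 1)) * (N - 2 : ℕ) := by
          simp
          ring
      _ ≤ _ := by
          gcongr
          omega
  have h3 := h2
  rw [Finset.sum_comm] at h3
  have h4 : ∑ m ∈ Finset.Ico 2 N, ∑ n ∈ Finset.Ico 2 N,
      (if m = n then B * (1 / ((n : ℝ) * Real.log n ^ 2)) else 0) ≤
      B * (1 / (2 * Real.log 2 ^ 2) + 1 / Real.log 2) := by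
    refine le_trans (le_of_eq ?_) (mul_le_mul_of_nonneg_left (aux_diag' N) hB)
    rw [Finset.mul_sum]
    apply Finset.sum_congr rfl
    intro m hm
    rw [Finset.sum_ite_eq, if_pos hm]
  simp only [Finset.sum_add_distrib]
  linarith

noncomputable def auxE (c lam t : ℝ) : ℂ :=
  (Set.Ioi c).indicator (fun t : ℝ => Complex.exp ((lam * Complex.I) * t)) t

lemma auxE_norm (c lam t : ℝ) : ‖auxE c lam t‖ ≤ 1 := by
  unfold auxE
  refine le_trans (norm_indicator_le_norm_self _ _) ?_
  rw [Complex.norm_exp]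
  simp

lemma auxE_int (c lam A B : ℝ) : IntervalIntegrable (auxE c lam) volume A B := by
  have h : Continuous (fun t : ℝ => Complex.exp ((lam * Complex.I) * t)) := by fun_prop
  have := h.intervalIntegrable (μ := volume) A B
  rw [intervalIntegrable_iff] at this ⊢
  exact this.indicator measurableSet_Ioi

lemma auxE_diag (c lam A B : ℝ) (hAB : A ≤ B) : ‖∫ t in A..B, auxE c lam t‖ ≤ B - A := by
  have := intervalIntegral.norm_integral_le_of_norm_le_const (a := A) (b := B) (C := 1)
    (f := auxE c lam) (fun t _ => auxE_norm c lam t)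
  rwa [one_mul, abs_of_nonneg (by linarith)] at this

lemma auxE_off (c lam A B : ℝ) (hAB : A ≤ B) (hl : lam ≠ 0) :
    ‖∫ t in A..B, auxE c lam t‖ ≤ 2 / |lam| := by
  unfold auxE
  rw [intervalIntegral.integral_of_le hAB, setIntegral_indicator measurableSet_Ioi,
    Set.Ioc_inter_Ioi]
  rcases le_total (A ⊔ c) B with h | h
  · rw [← intervalIntegral.integral_of_le h, integral_exp_mul_complex (by simpa using hl)]
    rw [norm_div]
    have h1 : ‖(lam : ℂ) * Complex.I‖ = |lam| := by simp
    rw [h1]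
    gcongr
    refine le_trans (norm_sub_le _ _) ?_
    rw [Complex.norm_exp, Complex.norm_exp]
    simp
    norm_num
  · rw [Set.Ioc_eq_empty (not_lt.mpr h)]
    simp only [Measure.restrict_empty, integral_zero_measure, norm_zero]
    positivity

/-- second moment -/
lemma aux_moment (N : ℕ) (c : ℕ → ℂ) (hc : ∀ n, 2 ≤ n → ‖c n‖ ≤ auxb n) (α A B : ℝ)
    (hA : 0 ≤ A) (hAB : A ≤ B) :
    (∫ t in A..B, ‖∑ n ∈ Finset.Ico 2 N, c n * auxE (α * n) (-Real.log n) t‖) ≤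
      B + (B * (1 / (2 * Real.log 2 ^ 2) + 1 / Real.log 2) +
        2 * (4 / Real.log 2 * (1 / Real.log 2 + 1)) * N) := by
  set S : ℝ → ℂ := fun t => ∑ n ∈ Finset.Ico 2 N, c n * auxE (α * n) (-Real.log n) t with hS
  have hSi : IntervalIntegrable S volume A B := by
    have := IntervalIntegrable.sum (μ := volume) (a := A) (b := B) (Finset.Ico 2 N)
      (f := fun n t => c n * auxE (α * n) (-Real.log n) t)
      (fun n _ => (auxE_int _ _ _ _).const_mul _)
    refine this.congr (fun t _ => ?_)
    simp [hS]
  have hprod : ∀ t, ((‖S t‖ ^ 2 : ℝ) : ℂ) = ∑ m ∈ Finset.Ico 2 N, ∑ n ∈ Finset.Ico 2 N,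
      (c m * (starRingEnd ℂ) (c n)) *
        auxE (α * m ⊔ α * n) (Real.log n - Real.log m) t := by
    intro t
    push_cast
    rw [← Complex.mul_conj', hS]
    simp only [map_sum, map_mul, Finset.sum_mul_sum]
    apply Finset.sum_congr rfl
    intro m _
    apply Finset.sum_congr rfl
    intro n _
    have : auxE (α * m ⊔ α * n) (Real.log n - Real.log m) t =
        auxE (α * m) (-Real.log m) t * (starRingEnd ℂ) (auxE (α * n) (-Real.log n) t) := by
      unfold auxE
      simp only [Set.indicator_apply, Set.mem_Ioi, sup_lt_iff]
      by_cases h1 : α * m < t <;> by_cases h2 : α * n < t <;>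
        simp only [h1, h2, and_true, and_false, if_true, if_false, mul_zero, zero_mul, map_zero]
      rw [← Complex.exp_conj, ← Complex.exp_add]
      congr 1
      rw [map_mul, map_mul, Complex.conj_I, Complex.conj_ofReal, Complex.conj_ofReal]
      push_cast
      ring
    rw [this]
    ring
  have hint : ∀ m n, IntervalIntegrable (fun t => (c m * (starRingEnd ℂ) (c n)) *
        auxE (α * m ⊔ α * n) (Real.log n - Real.log m) t) volume A B :=
    fun m n => (auxE_int _ _ _ _).const_mul _
  have hint1 : ∀ m, IntervalIntegrable (fun t => ∑ n ∈ Finset.Ico 2 N,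
      (c m * (starRingEnd ℂ) (c n)) *
        auxE (α * m ⊔ α * n) (Real.log n - Real.log m) t) volume A B := by
    intro m
    have := IntervalIntegrable.sum (μ := volume) (Finset.Ico 2 N) (fun n _ => hint m n)
    refine this.congr (fun t _ => ?_)
    simp
  have hint2 : IntervalIntegrable (fun t => ((‖S t‖ ^ 2 : ℝ) : ℂ)) volume A B := by
    have := IntervalIntegrable.sum (μ := volume) (Finset.Ico 2 N) (fun m _ => hint1 m)
    refine this.congr (fun t _ => ?_)
    simp only [hprod, Finset.sum_apply]
  have hint3 : IntervalIntegrable (fun t => ‖S t‖ ^ 2) volume A B := by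
    have := hint2.norm
    refine this.congr (fun t _ => ?_)
    simp
  have hsq : (∫ t in A..B, ‖S t‖ ^ 2) ≤ B * (1 / (2 * Real.log 2 ^ 2) + 1 / Real.log 2) +
        2 * (4 / Real.log 2 * (1 / Real.log 2 + 1)) * N := by
    have e1 : ((∫ t in A..B, ‖S t‖ ^ 2 : ℝ) : ℂ) = ∑ m ∈ Finset.Ico 2 N, ∑ n ∈ Finset.Ico 2 N,
      (c m * (starRingEnd ℂ) (c n)) *
        ∫ t in A..B, auxE (α * m ⊔ α * n) (Real.log n - Real.log m) t := by
      rw [← intervalIntegral.integral_ofReal]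
      simp_rw [hprod]
      rw [intervalIntegral.integral_finsetSum (fun m _ => hint1 m)]
      apply Finset.sum_congr rfl
      intro m _
      rw [intervalIntegral.integral_finsetSum (fun n _ => hint m n)]
      apply Finset.sum_congr rfl
      intro n _
      rw [intervalIntegral.integral_const_mul]
    refine le_trans (le_abs_self _) ?_
    rw [← Real.norm_eq_abs, ← Complex.norm_real, e1]
    refine le_trans ?_ (aux_double N B (by linarith)
      (fun m n => ‖∫ t in A..B, auxE (α * m ⊔ α * n) (Real.log n - Real.log m) t‖) ?_ ?_)
    · refine le_trans (norm_sum_le _ _) (Finset.sum_le_sum fun m hm => ?_)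
      refine le_trans (norm_sum_le _ _) (Finset.sum_le_sum fun n hn => ?_)
      rw [Finset.mem_Ico] at hm hn
      rw [norm_mul, norm_mul, RCLike.norm_conj]
      have h1 := hc m hm.1
      have h2 := hc n hn.1
      have h3 := (norm_nonneg (c m)).trans h1
      gcongr
    · intro n
      exact (auxE_diag _ _ _ _ hAB).trans (by linarith)
    · intro m n hm hn hmn
      refine auxE_off _ _ _ _ hAB ?_
      intro h
      apply hmn
      have h' := sub_eq_zero.mp h
      have := Real.log_injOn_pos (show (n : ℝ) ∈ Set.Ioi 0 from by
        simp only [Set.mem_Ioi]; exact_mod_cast hn) (show (m : ℝ) ∈ Set.Ioi 0 from by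
        simp only [Set.mem_Ioi]; exact_mod_cast hm) h'
      exact_mod_cast this.symm
  have hle : (∫ t in A..B, ‖S t‖) ≤ ∫ t in A..B, (1 + ‖S t‖ ^ 2) := by
    apply intervalIntegral.integral_mono_on hAB hSi.norm (intervalIntegrable_const.add hint3)
    intro t _
    nlinarith [sq_nonneg (‖S t‖ - 1), norm_nonneg (S t)]
  rw [intervalIntegral.integral_add intervalIntegrable_const hint3] at hle
  simp only [intervalIntegral.integral_const, smul_eq_mul, mul_one] at hle
  linarith

lemma aux_term (astar α k t : ℝ) (n : ℕ) (hn : 2 ≤ n) (h : α * n < t) :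
    Complex.exp (2 * Real.pi * Complex.I * n * astar) * (Real.sin (k * Real.log n) : ℂ) /
      ((n : ℂ) ^ ((1 : ℂ) / 2 + Complex.I * t) * (Real.log n : ℂ)) =
    (Complex.exp (2 * Real.pi * Complex.I * n * astar) * (Real.sin (k * Real.log n) : ℂ) /
      ((n : ℂ) ^ ((1 : ℂ) / 2) * (Real.log n : ℂ))) * auxE (α * n) (-Real.log n) t := by
  have hn0 : (n : ℂ) ≠ 0 := by exact_mod_cast (by omega : n ≠ 0)
  unfold auxE
  rw [Set.indicator_of_mem (show t ∈ Set.Ioi (α * n) from h)]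
  rw [Complex.cpow_add _ _ hn0]
  have : Complex.exp (((-Real.log n : ℝ) : ℂ) * Complex.I * t) =
      ((n : ℂ) ^ (Complex.I * t))⁻¹ := by
    rw [Complex.cpow_def_of_ne_zero hn0, ← Complex.exp_neg, ← Complex.natCast_log]
    congr 1
    push_cast
    ring
  rw [this]
  simp only [div_eq_mul_inv, mul_inv]
  ring

lemma aux_coef (astar k : ℝ) (n : ℕ) (hn : 2 ≤ n) :
    ‖Complex.exp (2 * Real.pi * Complex.I * n * astar) * (Real.sin (k * Real.log n) : ℂ) /
      ((n : ℂ) ^ ((1 : ℂ) / 2) * (Real.log n : ℂ))‖ ≤ auxb n := by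
  have hn0 : 0 < n := by omega
  have hl : 0 ≤ Real.log n := Real.log_natCast_nonneg n
  rw [norm_div, norm_mul, norm_mul, Complex.norm_natCast_cpow_of_pos hn0, Complex.norm_exp,
    Complex.norm_real, Complex.norm_real, Real.norm_eq_abs, Real.norm_eq_abs, abs_of_nonneg hl]
  unfold auxb
  have e : ((1 : ℂ) / 2).re = 1 / 2 := by simp
  rw [e, ← Real.sqrt_eq_rpow]
  have e2 : (2 * Real.pi * Complex.I * n * astar : ℂ).re = 0 := by
    simp
  rw [e2, Real.exp_zero, one_mul]
  gcongr
  exact Real.abs_sin_le_one _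

/-- First moment bound of Lemma 2.2 (second inequality); the constant is independent of
`k`, `A`, `B`. -/
theorem integral_abs_Ssum2_le (a : ℝ) (ha : 0 < a) (ha' : a < 1) (astar : ℝ)
    (hstar : astar = a ∨ astar = 1 - a) :
    ∃ C₄ > (0 : ℝ), ∀ k A B : ℝ, 2 / min a (1 - a) ≤ A → A ≤ B →
      (∫ t in A..B, ‖Ssum2 astar (min a (1 - a)) k t‖) ≤ C₄ * B := by
  have hα : 0 < min a (1 - a) := lt_min ha (by linarith)
  have hα1 : min a (1 - a) < 1 := lt_of_le_of_lt (min_le_left _ _) ha'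
  generalize min a (1 - a) = α at hα hα1
  have hl2 := aux_l2pos
  refine ⟨1 + ((1 / (2 * Real.log 2 ^ 2) + 1 / Real.log 2) +
        2 * (4 / Real.log 2 * (1 / Real.log 2 + 1)) * (1 / α + 1)), by positivity, ?_⟩
  intro k A B hA hAB
  have hA2 : 1 ≤ A := by
    refine le_trans ?_ hA
    rw [le_div_iff₀ hα]
    linarith
  have hN : (⌈B / α⌉₊ : ℝ) ≤ (1 / α + 1) * B := by
    have := Nat.ceil_lt_add_one (show 0 ≤ B / α from div_nonneg (by linarith) hα.le)
    have e : (1 / α + 1) * B = B / α + B := by ring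
    rw [e]
    linarith
  have key := aux_moment ⌈B / α⌉₊ (fun n =>
    Complex.exp (2 * Real.pi * Complex.I * n * astar) * (Real.sin (k * Real.log n) : ℂ) /
      ((n : ℂ) ^ ((1 : ℂ) / 2) * (Real.log n : ℂ))) (fun n hn => aux_coef astar k n hn) α A B
      (by linarith) hAB
  have hcongr : (∫ t in A..B, ‖Ssum2 astar α k t‖) = ∫ t in A..B,
      ‖∑ n ∈ Finset.Ico 2 ⌈B / α⌉₊, (Complex.exp (2 * Real.pi * Complex.I * n * astar) *
        (Real.sin (k * Real.log n) : ℂ) /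
      ((n : ℂ) ^ ((1 : ℂ) / 2) * (Real.log n : ℂ))) * auxE (α * n) (-Real.log n) t‖ := by
    apply intervalIntegral.integral_congr
    intro t ht
    rw [Set.uIcc_of_le hAB] at ht
    simp only
    congr 1
    unfold Ssum2
    have hsub : Finset.Ico 2 ⌈t / α⌉₊ ⊆ Finset.Ico 2 ⌈B / α⌉₊ := by
      apply Finset.Ico_subset_Ico_right
      apply Nat.ceil_mono
      have := ht.2
      gcongr
    rw [← Finset.sum_subset hsub]
    · apply Finset.sum_congr rfl
      intro n hn
      rw [Finset.mem_Ico, Nat.lt_ceil, lt_div_iff₀ hα] at hn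
      exact aux_term astar α k t n hn.1 (by linarith [hn.2])
    · intro n hn hn'
      rw [Finset.mem_Ico] at hn
      rw [Finset.mem_Ico, Nat.lt_ceil, lt_div_iff₀ hα] at hn'
      unfold auxE
      rw [Set.indicator_of_notMem, mul_zero]
      intro h
      exact hn' ⟨hn.1, by rw [mul_comm]; exact h⟩
  rw [hcongr]
  refine le_trans key ?_
  have h5 : 2 * (4 / Real.log 2 * (1 / Real.log 2 + 1)) * (⌈B / α⌉₊ : ℝ) ≤
      2 * (4 / Real.log 2 * (1 / Real.log 2 + 1)) * ((1 / α + 1) * B) := by gcongr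
  linarith
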